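/- arXiv:2105.12165 — 3 statements merged into one kernel-verified Lean document; each statement's English description precedes it below -/
import Mathlib

section
/- Let T be an invertible real 3 × 3 matrix. Then the mesh quality metric μ_302(T) = ‖T‖_F² · ‖T⁻¹‖_F² / 9 − 1 satisfies μ_302(T) ≥ 0, with equality if and only if T is a positive scalar multiple of an orthogonal matrix. -/
open Matrix

/-- The squared Frobenius norm of a real matrix. -/
def frobSq {d : ℕ} (T : Matrix (Fin d) (Fin d) ℝ) : ℝ := ∑ i, ∑ j, (T i j) ^ 2

theorem frobSq_eq_trace {d : ℕ} (T : Matrix (Fin d) (Fin d) ℝ) :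
    frobSq T = (Tᵀ * T).trace := by
  simp only [frobSq, trace, diag_apply, mul_apply, transpose_apply, pow_two]
  exact Finset.sum_comm

theorem frobSq_nonneg {d : ℕ} (T : Matrix (Fin d) (Fin d) ℝ) : 0 ≤ frobSq T :=
  Finset.sum_nonneg fun _ _ => Finset.sum_nonneg fun _ _ => sq_nonneg _

theorem frobSq_eq_zero_iff {d : ℕ} (T : Matrix (Fin d) (Fin d) ℝ) : frobSq T = 0 ↔ T = 0 := by
  rw [frobSq_eq_trace, ← conjTranspose_eq_transpose_of_trivial,
    trace_conjTranspose_mul_self_eq_zero_iff]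

theorem frobSq_transpose {d : ℕ} (T : Matrix (Fin d) (Fin d) ℝ) : frobSq Tᵀ = frobSq T := by
  rw [frobSq_eq_trace, frobSq_eq_trace, transpose_transpose, trace_mul_comm]

theorem frobSq_smul {d : ℕ} (c : ℝ) (T : Matrix (Fin d) (Fin d) ℝ) :
    frobSq (c • T) = c ^ 2 * frobSq T := by
  simp [frobSq, mul_pow, Finset.mul_sum]

theorem frobSq_of_transpose_mul_self {d : ℕ} {R : Matrix (Fin d) (Fin d) ℝ} (hR : Rᵀ * R = 1) :
    frobSq R = d := by
  simp [frobSq_eq_trace, hR]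

theorem frobSq_sub {d : ℕ} (A B : Matrix (Fin d) (Fin d) ℝ) :
    frobSq (A - B) = frobSq A - 2 * (Bᵀ * A).trace + frobSq B := by
  have h : (Aᵀ * B).trace = (Bᵀ * A).trace := by
    rw [← trace_transpose, transpose_mul, transpose_transpose]
  simp only [frobSq_eq_trace, transpose_sub, sub_mul, mul_sub, trace_sub, h]
  ring

/-- The defect in the Cauchy–Schwarz inequality for `T` and `(T⁻¹)ᵀ`. -/
theorem frobSq_smul_inv_sub {d : ℕ} (T : Matrix (Fin d) (Fin d) ℝ) (hT : IsUnit T.det) :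
    frobSq (frobSq T • T⁻¹ - (d : ℝ) • Tᵀ) =
      frobSq T * (frobSq T * frobSq T⁻¹ - (d : ℝ) ^ 2) := by
  rw [frobSq_sub, frobSq_smul, frobSq_smul, frobSq_transpose]
  simp only [transpose_smul, transpose_transpose, smul_mul_assoc, mul_smul_comm,
    mul_nonsing_inv T hT, trace_smul, trace_one, Fintype.card_fin, smul_eq_mul]
  ring

theorem frobSq_pos {d : ℕ} [NeZero d] (T : Matrix (Fin d) (Fin d) ℝ) (hT : IsUnit T.det) :
    0 < frobSq T := by
  refine (frobSq_nonneg T).lt_of_ne' fun h => ?_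
  rw [(frobSq_eq_zero_iff T).1 h, det_zero] at hT
  exact not_isUnit_zero hT

theorem sq_le_frobSq_mul_frobSq_inv {d : ℕ} [NeZero d] (T : Matrix (Fin d) (Fin d) ℝ)
    (hT : IsUnit T.det) : (d : ℝ) ^ 2 ≤ frobSq T * frobSq T⁻¹ := by
  have h := frobSq_nonneg (frobSq T • T⁻¹ - (d : ℝ) • Tᵀ)
  rw [frobSq_smul_inv_sub T hT] at h
  exact sub_nonneg.1 (nonneg_of_mul_nonneg_right h (frobSq_pos T hT))

theorem frobSq_mul_frobSq_inv_eq_iff {d : ℕ} [NeZero d] (T : Matrix (Fin d) (Fin d) ℝ)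
    (hT : IsUnit T.det) :
    frobSq T * frobSq T⁻¹ = (d : ℝ) ^ 2 ↔
      ∃ c : ℝ, 0 < c ∧ ∃ R : Matrix (Fin d) (Fin d) ℝ, Rᵀ * R = 1 ∧ T = c • R := by
  have hd : (0 : ℝ) < d := Nat.cast_pos.2 (NeZero.pos d)
  constructor
  · intro h
    have hpos := frobSq_pos T hT
    have hz := frobSq_smul_inv_sub T hT
    rw [h, sub_self, mul_zero, frobSq_eq_zero_iff, sub_eq_zero] at hz
    have hTT : Tᵀ * T = (frobSq T / d) • (1 : Matrix (Fin d) (Fin d) ℝ) := by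
      have h1 := congrArg (fun M => (d : ℝ)⁻¹ • (M * T)) hz
      simp only [smul_mul_assoc, nonsing_inv_mul T hT, smul_smul, inv_mul_cancel₀ hd.ne',
        one_smul] at h1
      rw [← h1, div_eq_inv_mul]
    have hk : 0 < frobSq T / d := div_pos hpos hd
    have hc := Real.sqrt_pos.2 hk
    refine ⟨√(frobSq T / d), hc, (√(frobSq T / d))⁻¹ • T, ?_, ?_⟩
    · rw [transpose_smul, smul_mul_assoc, mul_smul_comm, hTT, smul_smul, smul_smul,
        ← mul_inv, Real.mul_self_sqrt hk.le, inv_mul_cancel₀ hk.ne', one_smul]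
    · rw [smul_smul, mul_inv_cancel₀ hc.ne', one_smul]
  · rintro ⟨c, hc, R, hR, rfl⟩
    have hinv : (c • R)⁻¹ = c⁻¹ • Rᵀ := by
      refine inv_eq_left_inv ?_
      rw [smul_mul_assoc, mul_smul_comm, hR, smul_smul, inv_mul_cancel₀ hc.ne', one_smul]
    rw [hinv, frobSq_smul, frobSq_smul, frobSq_transpose, frobSq_of_transpose_mul_self hR]
    field_simp

/-- For an invertible real `3 × 3` matrix `T`, the mesh quality
metric `μ_302(T) = ‖T‖_F² ‖T⁻¹‖_F² / 9 − 1` is nonnegative, and vanishes iff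
`T` is a positive scalar multiple of an orthogonal matrix. -/
theorem stmt_6 (T : Matrix (Fin 3) (Fin 3) ℝ) (hT : IsUnit T.det) :
    0 ≤ frobSq T * frobSq T⁻¹ / 9 - 1 ∧
      (frobSq T * frobSq T⁻¹ / 9 - 1 = 0 ↔
        ∃ c : ℝ, 0 < c ∧ ∃ R : Matrix (Fin 3) (Fin 3) ℝ,
          Rᵀ * R = 1 ∧ T = c • R) := by
  have hle := sq_le_frobSq_mul_frobSq_inv T hT
  rw [← frobSq_mul_frobSq_inv_eq_iff T hT]
  push_cast at hle ⊢
  refine ⟨by linarith, fun h => by linarith, fun h => by linarith⟩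
end

section
/- Let T be a real 2 × 2 matrix with τ = det T > 0, and let μ_80(T) = (1/2)·μ_2(T) + (1/2)·μ_77(T), where μ_2(T) = ‖T‖_F²/(2τ) − 1 and μ_77(T) = (1/2)(τ − 1/τ)². Then μ_80(T) ≥ 0, with equality if and only if T ∈ SO(2), i.e. if and only if T is a rotation matrix. -/
open Matrix

/-- For `T = !![a, b; c, d]`, `‖T‖_F² / (2 det T) - 1 = ((a - d)² + (b + c)²) / (2 det T)`. -/
theorem frobSq_div_two_mul_det_sub_one (T : Matrix (Fin 2) (Fin 2) ℝ) (hT : T.det ≠ 0) :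
    frobSq T / (2 * T.det) - 1 =
      ((T 0 0 - T 1 1) ^ 2 + (T 0 1 + T 1 0) ^ 2) / (2 * T.det) := by
  have h : frobSq T = (T 0 0 - T 1 1) ^ 2 + (T 0 1 + T 1 0) ^ 2 + 2 * T.det := by
    simp only [frobSq, Fin.sum_univ_two, det_fin_two]
    ring
  rw [h, add_div, div_self (mul_ne_zero two_ne_zero hT), add_sub_cancel_right]

/-- For a real `2 × 2` matrix `T` with `det T > 0`, the composite
metric `μ_80 = (1/2) μ_2 + (1/2) μ_77`, with `μ_2(T) = ‖T‖_F²/(2τ) − 1` and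
`μ_77(T) = (1/2)(τ − 1/τ)²`, is nonnegative, with equality iff `T ∈ SO(2)`
(orthogonal with determinant 1, i.e. a rotation matrix). -/
theorem stmt_10 (T : Matrix (Fin 2) (Fin 2) ℝ) (hτ : 0 < T.det) :
    0 ≤ (1 / 2) * (frobSq T / (2 * T.det) - 1) +
        (1 / 2) * ((1 / 2) * (T.det - 1 / T.det) ^ 2) ∧
      ((1 / 2) * (frobSq T / (2 * T.det) - 1) +
        (1 / 2) * ((1 / 2) * (T.det - 1 / T.det) ^ 2) = 0 ↔
        Tᵀ * T = 1 ∧ T.det = 1) := by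
  have h₂ : 0 ≤ frobSq T / (2 * T.det) - 1 := by
    rw [frobSq_div_two_mul_det_sub_one T hτ.ne']
    positivity
  have h₇₇ : 0 ≤ (T.det - 1 / T.det) ^ 2 := sq_nonneg _
  refine ⟨by linarith, fun h => ?_, fun ⟨hT, hdet⟩ => ?_⟩
  · have hshape : frobSq T / (2 * T.det) - 1 = 0 := by linarith
    have hsize : T.det - 1 / T.det = 0 := pow_eq_zero_iff two_ne_zero |>.1 (by linarith)
    have hdet : T.det = 1 := by
      field_simp at hsize
      nlinarith
    rw [frobSq_div_two_mul_det_sub_one T hτ.ne', hdet] at hshape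
    have hdiag : T 0 0 = T 1 1 := by
      nlinarith [sq_nonneg (T 0 0 - T 1 1), sq_nonneg (T 0 1 + T 1 0)]
    have hoff : T 0 1 = -T 1 0 := by
      nlinarith [sq_nonneg (T 0 0 - T 1 1), sq_nonneg (T 0 1 + T 1 0)]
    refine ⟨?_, hdet⟩
    rw [det_fin_two, hdiag, hoff] at hdet
    ext i j
    fin_cases i <;> fin_cases j <;> simp [mul_apply, Fin.sum_univ_two, hdiag, hoff] <;> linarith
  · rw [frobSq_eq_trace, hT, hdet]
    norm_num [trace_fin_two]
end

section
/- Let T be a real 2 × 2 matrix with τ = det T > 0, and define the shape metric μ_58(T) = ‖TᵀT‖_F²/τ² − 2‖T‖_F²/τ + 2. Then μ_58(T) = k(k − 2) with k = ‖T‖_F²/τ, and consequently μ_58(T) ≥ 0, with equality if and only if T = c·R for some real c > 0 and some rotation matrix R ∈ SO(2). -/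
open Matrix

theorem frobSq_transpose_mul_self_fin_two (T : Matrix (Fin 2) (Fin 2) ℝ) :
    frobSq (Tᵀ * T) = frobSq T ^ 2 - 2 * T.det ^ 2 := by
  simp only [frobSq, Fin.sum_univ_two, Matrix.mul_apply, Matrix.transpose_apply,
    Matrix.det_fin_two]
  ring

theorem frobSq_sub_two_mul_det_fin_two (T : Matrix (Fin 2) (Fin 2) ℝ) :
    frobSq T - 2 * T.det = (T 0 0 - T 1 1) ^ 2 + (T 0 1 + T 1 0) ^ 2 := by
  simp only [frobSq, Fin.sum_univ_two, Matrix.det_fin_two]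
  ring

theorem transpose_mul_self_of_frobSq_eq (T : Matrix (Fin 2) (Fin 2) ℝ)
    (h : frobSq T = 2 * T.det) : Tᵀ * T = T.det • (1 : Matrix (Fin 2) (Fin 2) ℝ) := by
  have key := frobSq_sub_two_mul_det_fin_two T
  have h₁ : T 0 0 = T 1 1 := by nlinarith [sq_nonneg (T 0 0 - T 1 1), sq_nonneg (T 0 1 + T 1 0)]
  have h₂ : T 0 1 = -T 1 0 := by nlinarith [sq_nonneg (T 0 0 - T 1 1), sq_nonneg (T 0 1 + T 1 0)]
  ext i j
  fin_cases i <;> fin_cases j <;>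
    simp [Matrix.mul_apply, Fin.sum_univ_two, Matrix.det_fin_two, h₁, h₂] <;> ring

/-- A real `2 × 2` matrix of positive determinant satisfies `‖T‖_F² = 2 det T` exactly when it is
a positive multiple of a rotation. -/
theorem frobSq_eq_two_mul_det_iff (T : Matrix (Fin 2) (Fin 2) ℝ) (hτ : 0 < T.det) :
    frobSq T = 2 * T.det ↔ ∃ c : ℝ, 0 < c ∧ ∃ R : Matrix (Fin 2) (Fin 2) ℝ,
      Rᵀ * R = 1 ∧ R.det = 1 ∧ T = c • R := by
  constructor
  · intro h
    have hc : 0 < √T.det := Real.sqrt_pos.2 hτ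
    have hsq : (√T.det)⁻¹ * (√T.det)⁻¹ * T.det = 1 := by
      rw [← mul_inv, Real.mul_self_sqrt hτ.le, inv_mul_cancel₀ hτ.ne']
    refine ⟨√T.det, hc, (√T.det)⁻¹ • T, ?_, ?_, ?_⟩
    · rw [Matrix.transpose_smul, Matrix.smul_mul, Matrix.mul_smul,
        transpose_mul_self_of_frobSq_eq T h, smul_smul, smul_smul, hsq, one_smul]
    · rw [Matrix.det_smul, Fintype.card_fin, pow_two, hsq]
    · rw [smul_inv_smul₀ hc.ne']
  · rintro ⟨c, -, R, hR, hdet, rfl⟩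
    rw [frobSq_eq_trace, Matrix.transpose_smul, Matrix.smul_mul, Matrix.mul_smul, hR,
      Matrix.det_smul, hdet]
    simp
    ring

/-- For a real `2 × 2` matrix `T` with `τ = det T > 0`, the shape
metric `μ_58(T) = ‖TᵀT‖_F²/τ² − 2‖T‖_F²/τ + 2` equals `k(k − 2)` with
`k = ‖T‖_F²/τ`; consequently `μ_58(T) ≥ 0`, with equality iff `T = c • R` with
`c > 0` and `R ∈ SO(2)`. -/
theorem stmt_13 (T : Matrix (Fin 2) (Fin 2) ℝ) (hτ : 0 < T.det) :
    frobSq (Tᵀ * T) / T.det ^ 2 - 2 * frobSq T / T.det + 2 =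
        (frobSq T / T.det) * (frobSq T / T.det - 2) ∧
      0 ≤ frobSq (Tᵀ * T) / T.det ^ 2 - 2 * frobSq T / T.det + 2 ∧
      (frobSq (Tᵀ * T) / T.det ^ 2 - 2 * frobSq T / T.det + 2 = 0 ↔
        ∃ c : ℝ, 0 < c ∧ ∃ R : Matrix (Fin 2) (Fin 2) ℝ,
          Rᵀ * R = 1 ∧ R.det = 1 ∧ T = c • R) := by
  have hk : frobSq (Tᵀ * T) / T.det ^ 2 - 2 * frobSq T / T.det + 2 =
      (frobSq T / T.det) * (frobSq T / T.det - 2) := by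
    rw [frobSq_transpose_mul_self_fin_two]
    field_simp
    ring
  have h2 : 2 ≤ frobSq T / T.det := by
    rw [le_div_iff₀ hτ, ← sub_nonneg, frobSq_sub_two_mul_det_fin_two]
    positivity
  refine ⟨hk, ?_, ?_⟩
  · rw [hk]
    exact mul_nonneg (by linarith) (by linarith)
  · rw [hk, ← frobSq_eq_two_mul_det_iff T hτ, mul_eq_zero_iff_left (by linarith), sub_eq_zero,
      div_eq_iff hτ.ne']
end
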